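/- (Existence of g-vectors.) Let B=(b_{ij}) be an n×n skew-symmetrizable integer matrix. Then every cluster variable z of the cluster algebra with principal coefficients A(B) is homogeneous for the ℤ^n-grading with deg(x_i) = e_i and deg(y_j) = -∑_{i=1}^n b_{ij} e_i: there exist a vector g ∈ ℤ^n and a finitely supported function f : ℤ^n × (ℤ_{≥0})^n → ℤ such that z = ∑_{(a,c)} f(a,c) · x_1^{a_1}⋯x_n^{a_n} y_1^{c_1}⋯y_n^{c_n} in F, and f(a,c) ≠ 0 implies a - Bc = g (here Bc denotes the matrix-vector product). -/

import Mathlib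

noncomputable section

/-- The ambient field `F`: the field of rational functions in `2n` variables over `ℚ`,
realized as the fraction field of the polynomial ring in the `2n` indeterminates
`x_1, …, x_n` (indexed by `Sum.inl`) and `y_1, …, y_n` (indexed by `Sum.inr`). -/
abbrev CField (n : ℕ) : Type := FractionRing (MvPolynomial (Fin n ⊕ Fin n) ℚ)

/-- The initial cluster variables `x_1, …, x_n` and coefficients `y_1, …, y_n`:
the images in `F` of the `2n` standard indeterminates. -/
def initX (n : ℕ) : Fin n ⊕ Fin n → CField n :=
  fun i => algebraMap (MvPolynomial (Fin n ⊕ Fin n) ℚ) (CField n) (MvPolynomial.X i)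

/-- Mutation of an integer matrix (rows indexed by `ρ`, columns by `Fin n`) at column `k`,
where `e : Fin n → ρ` identifies each column index with a row index. -/
def matMutate {ρ : Type*} [DecidableEq ρ] {n : ℕ} (e : Fin n → ρ)
    (A : Matrix ρ (Fin n) ℤ) (k : Fin n) : Matrix ρ (Fin n) ℤ :=
  fun i j =>
    if i = e k ∨ j = k then -A i j
    else A i j + A i k * max (A (e k) j) 0 + max (-A i k) 0 * A (e k) j

/-- The mutated `2n`-tuple of the seed mutation at `k`. -/
def seedMutX {n : ℕ} (x : Fin n ⊕ Fin n → CField n)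
    (A : Matrix (Fin n ⊕ Fin n) (Fin n) ℤ) (k : Fin n) : Fin n ⊕ Fin n → CField n
  | Sum.inl i =>
      if i = k then
        (x (Sum.inl k))⁻¹ *
          ((∏ i' : Fin n, x (Sum.inl i') ^ (A (Sum.inl i') k).toNat) *
              (∏ i' : Fin n, x (Sum.inr i') ^ (A (Sum.inr i') k).toNat) +
            (∏ i' : Fin n, x (Sum.inl i') ^ (-(A (Sum.inl i') k)).toNat) *
              (∏ i' : Fin n, x (Sum.inr i') ^ (-(A (Sum.inr i') k)).toNat))
      else x (Sum.inl i)
  | Sum.inr i => x (Sum.inr i)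

/-- Mutation of a pair (`2n`-tuple, `2n × n` matrix) at `k`. -/
def mutatePair {n : ℕ}
    (p : (Fin n ⊕ Fin n → CField n) × Matrix (Fin n ⊕ Fin n) (Fin n) ℤ)
    (k : Fin n) : (Fin n ⊕ Fin n → CField n) × Matrix (Fin n ⊕ Fin n) (Fin n) ℤ :=
  (seedMutX p.1 p.2 k, matMutate Sum.inl p.2 k)

/-- The principal extension `B̂` of an `n × n` matrix `B`: the `2n × n` matrix whose upper
part is `B` and whose lower part is the identity matrix. -/
def principalExt {n : ℕ} (B : Matrix (Fin n) (Fin n) ℤ) :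
    Matrix (Fin n ⊕ Fin n) (Fin n) ℤ
  | Sum.inl i, j => B i j
  | Sum.inr i, j => if i = j then 1 else 0

/-- `z` is a cluster variable of the cluster algebra with principal coefficients `A(B)`. -/
def IsClusterVariable {n : ℕ} (B : Matrix (Fin n) (Fin n) ℤ) (z : CField n) : Prop :=
  ∃ (L : List (Fin n)) (i : Fin n),
    z = (L.foldl mutatePair (initX n, principalExt B)).1 (Sum.inl i)


/-! ### Matrix mutation -/

structure GoodMat {n : ℕ} (A : Matrix (Fin n ⊕ Fin n) (Fin n) ℤ) : Prop where
  skew : ∃ d : Fin n → ℤ, (∀ i, 0 < d i) ∧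
    ∀ i j, A (Sum.inl i) j * d j = -A (Sum.inl j) i * d i
  inj : ∀ v : Fin n → ℤ, (∀ i, ∑ j, A i j * v j = 0) → v = 0

theorem GoodMat.diag {n : ℕ} {A : Matrix (Fin n ⊕ Fin n) (Fin n) ℤ} (h : GoodMat A) (k : Fin n) :
    A (Sum.inl k) k = 0 := by
  obtain ⟨d, hd, h2⟩ := h.skew
  have := h2 k k
  have h3 := hd k
  have : A (Sum.inl k) k * d k = 0 := by linarith
  rcases mul_eq_zero.mp this with h | h
  · exact h
  · omega

theorem GoodMat.sign {n : ℕ} {A : Matrix (Fin n ⊕ Fin n) (Fin n) ℤ} (h : GoodMat A) {j k : Fin n}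
    (hjk : A (Sum.inl j) k ≤ 0) : 0 ≤ A (Sum.inl k) j := by
  obtain ⟨d, hd, h2⟩ := h.skew
  have h1 := h2 j k
  have := hd j
  have := hd k
  by_contra hc
  push Not at hc
  nlinarith

theorem GoodMat.zero {n : ℕ} {A : Matrix (Fin n ⊕ Fin n) (Fin n) ℤ} (h : GoodMat A) {j k : Fin n}
    (hjk : A (Sum.inl j) k = 0) : A (Sum.inl k) j = 0 := by
  obtain ⟨d, hd, h2⟩ := h.skew
  have h1 := h2 j k
  have := hd j
  rw [hjk] at h1
  have : A (Sum.inl k) j * d j = 0 := by linarith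
  rcases mul_eq_zero.mp this with h | h
  · exact h
  · omega

theorem GoodMat.neg {n : ℕ} {A : Matrix (Fin n ⊕ Fin n) (Fin n) ℤ} (h : GoodMat A) :
    GoodMat (-A) := by
  obtain ⟨d, hd, h2⟩ := h.skew
  refine ⟨⟨d, hd, fun i j => ?_⟩, fun v hv => h.inj v fun i => ?_⟩
  · have := h2 i j
    simp only [Matrix.neg_apply]
    linarith
  · have := hv i
    simp only [Matrix.neg_apply, neg_mul, Finset.sum_neg_distrib] at this
    linarith

theorem matMutate_neg {n : ℕ} (A : Matrix (Fin n ⊕ Fin n) (Fin n) ℤ) (k : Fin n) :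
    matMutate Sum.inl (-A) k = -matMutate Sum.inl A k := by
  ext i j
  simp only [matMutate, Matrix.neg_apply]
  split_ifs
  · rfl
  · rcases max_cases (-A i k) 0 with h | h <;> rcases max_cases (A (Sum.inl k) j) 0 with h' | h' <;>
    rcases max_cases (- -A i k) 0 with h1 | h1 <;>
    rcases max_cases (-A (Sum.inl k) j) 0 with h1' | h1' <;>
    rw [h.1, h'.1, h1.1, h1'.1] <;> try ring1
    all_goals
      have e1 : A i k = 0 ∨ A (Sum.inl k) j = 0 := by omega
      rcases e1 with e | e <;> rw [e] <;> ring

theorem matMutate_row {n : ℕ} (A : Matrix (Fin n ⊕ Fin n) (Fin n) ℤ) (k j : Fin n) :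
    matMutate Sum.inl A k (Sum.inl k) j = - A (Sum.inl k) j := by simp [matMutate]

theorem matMutate_col {n : ℕ} (A : Matrix (Fin n ⊕ Fin n) (Fin n) ℤ) (k : Fin n)
    (i : Fin n ⊕ Fin n) : matMutate Sum.inl A k i k = - A i k := by simp [matMutate]

theorem matMutate_of_ne {n : ℕ} (A : Matrix (Fin n ⊕ Fin n) (Fin n) ℤ) (k j : Fin n)
    (i : Fin n ⊕ Fin n) (hi : i ≠ Sum.inl k) (hj : j ≠ k) : matMutate Sum.inl A k i j =
      A i j + A i k * max (A (Sum.inl k) j) 0 + max (-A i k) 0 * A (Sum.inl k) j := by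
  simp [matMutate, hi, hj]

theorem matMutate_matMutate {n : ℕ} {A : Matrix (Fin n ⊕ Fin n) (Fin n) ℤ} (k : Fin n) :
    matMutate Sum.inl (matMutate Sum.inl A k) k = A := by
  ext i j
  by_cases hi : i = Sum.inl k
  · subst hi; simp [matMutate_row]
  by_cases hj : j = k
  · subst hj; simp [matMutate_col]
  rw [matMutate_of_ne _ _ _ _ hi hj, matMutate_of_ne _ _ _ _ hi hj, matMutate_row, matMutate_col]
  rcases max_cases (-A i k) 0 with h | h <;> rcases max_cases (A (Sum.inl k) j) 0 with h' | h' <;>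
    rcases max_cases (- -A i k) 0 with h1 | h1 <;>
    rcases max_cases (-A (Sum.inl k) j) 0 with h1' | h1' <;>
    rw [h.1, h'.1, h1.1, h1'.1] <;> try ring1
  all_goals
      have e1 : A i k = 0 ∨ A (Sum.inl k) j = 0 := by omega
      rcases e1 with e | e <;> rw [e] <;> ring

theorem max_mul_pos {a b c d : ℤ} (hc : 0 < c) (hd : 0 < d) (h : a * c = b * d) :
    max a 0 * c = max b 0 * d := by
  rw [max_mul_of_nonneg _ _ hc.le, max_mul_of_nonneg _ _ hd.le, h]; simp

theorem GoodMat.mutate {n : ℕ} {A : Matrix (Fin n ⊕ Fin n) (Fin n) ℤ} (h : GoodMat A) (k : Fin n) :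
    GoodMat (matMutate Sum.inl A k) := by
  have hkk := h.diag k
  obtain ⟨d, hd, h2⟩ := h.skew
  refine ⟨⟨d, hd, fun i j => ?_⟩, fun v hv => ?_⟩
  · by_cases hi : i = k
    · subst hi; rw [matMutate_row, matMutate_col]; have := h2 i j; linarith
    by_cases hj : j = k
    · subst hj; rw [matMutate_row, matMutate_col]; have := h2 i j; linarith
    rw [matMutate_of_ne _ _ _ _ (by simpa using hi) hj,
      matMutate_of_ne _ _ _ _ (by simpa using hj) hi]
    have e1 := h2 i j
    have e2 := h2 i k
    have e3 := h2 k j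
    have f1 : max (A (Sum.inl k) j) 0 * d j = max (-A (Sum.inl j) k) 0 * d k :=
      max_mul_pos (hd j) (hd k) e3
    have f2 : max (A (Sum.inl k) i) 0 * d i = max (-A (Sum.inl i) k) 0 * d k :=
      max_mul_pos (hd i) (hd k) (by linarith)
    linear_combination e1 + A (Sum.inl i) k * f1 + max (-A (Sum.inl i) k) 0 * e3 +
      max (-A (Sum.inl j) k) 0 * e2 + A (Sum.inl j) k * f2
  · have hw := h.inj (fun j => if j = k then (∑ j, max (A (Sum.inl k) j) 0 * v j) - v k else v j) ?_
    · have hne : ∀ j, j ≠ k → v j = 0 := fun j hj => by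
        have := congrFun hw j
        simpa [hj] using this
      have hk := congrFun hw k
      simp only [if_true, Pi.zero_apply] at hk
      rw [Finset.sum_eq_zero] at hk
      · ext j
        by_cases hj : j = k
        · subst hj; simp; linarith
        · exact hne j hj
      · intro j _
        by_cases hj : j = k
        · subst hj; simp [hkk]
        · simp [hne j hj]
    · have hrow : ∑ j, A (Sum.inl k) j * v j = 0 := by
        have := hv (Sum.inl k)
        simp only [matMutate_row, neg_mul, Finset.sum_neg_distrib] at this
        linarith
      intro i
      have key : ∀ u : Fin n → ℤ, ∑ j, u j = u k + ∑ j ∈ Finset.univ.erase k, u j := fun u =>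
        (Finset.add_sum_erase _ _ (Finset.mem_univ k)).symm
      by_cases hi : i = Sum.inl k
      · subst hi
        rw [key] at hrow ⊢
        simp only [hkk, zero_mul, zero_add] at hrow ⊢
        rw [← hrow]
        refine Finset.sum_congr rfl fun j hj => ?_
        rw [if_neg (Finset.ne_of_mem_erase hj)]
      · have h0 := hv i
        have hs : ∑ j, matMutate Sum.inl A k i j * v j =
            ∑ j, (A i j * v j + A i k * (max (A (Sum.inl k) j) 0 * v j) +
              max (-A i k) 0 * (A (Sum.inl k) j * v j)) - 2 * A i k * v k := by
          rw [key, key, matMutate_col, hkk]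
          have : ∀ j ∈ Finset.univ.erase k, matMutate Sum.inl A k i j * v j =
            (A i j * v j + A i k * (max (A (Sum.inl k) j) 0 * v j) +
              max (-A i k) 0 * (A (Sum.inl k) j * v j)) := fun j hj => by
            rw [matMutate_of_ne _ _ _ _ hi (Finset.ne_of_mem_erase hj)]; ring
          rw [Finset.sum_congr rfl this]
          simp; ring
        rw [hs, Finset.sum_add_distrib, Finset.sum_add_distrib, ← Finset.mul_sum,
          ← Finset.mul_sum, hrow] at h0
        generalize (∑ j, max (A (Sum.inl k) j) 0 * v j) = S at h0 ⊢
        have h3 : ∑ j, A i j * (if j = k then S - v k else v j)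
          = ∑ j, A i j * v j + A i k * (S - 2 * v k) := by
          rw [key, key (fun j => A i j * v j), if_pos rfl]
          rw [Finset.sum_congr rfl (g := fun j => A i j * v j)]
          · ring
          · intro j hj
            rw [if_neg (Finset.ne_of_mem_erase hj)]
        rw [h3]
        linarith

theorem GoodMat.principal {n : ℕ} {B : Matrix (Fin n) (Fin n) ℤ}
    (hskew : ∃ d : Fin n → ℤ, (∀ i, 0 < d i) ∧ ∀ i j, B i j * d j = -B j i * d i) :
    GoodMat (principalExt B) := by
  refine ⟨hskew, fun v hv => ?_⟩
  ext i
  have := hv (Sum.inr i)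
  simpa [principalExt] using this


/-! ### Seeds -/

def exch {ι : Type*} [Fintype ι] {n : ℕ} {R : Type*} [CommRing R] (x : ι → R)
    (A : Matrix ι (Fin n) ℤ) (k : Fin n) : R :=
  ∏ i, x i ^ (A i k).toNat + ∏ i, x i ^ (-(A i k)).toNat

theorem seedMutX_self {n : ℕ} (x : Fin n ⊕ Fin n → CField n)
    (A : Matrix (Fin n ⊕ Fin n) (Fin n) ℤ) (k : Fin n) :
    seedMutX x A k (Sum.inl k) = (x (Sum.inl k))⁻¹ * exch x A k := by
  simp [seedMutX, exch]

theorem seedMutX_of_ne {n : ℕ} (x : Fin n ⊕ Fin n → CField n)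
    (A : Matrix (Fin n ⊕ Fin n) (Fin n) ℤ) (k : Fin n) (i : Fin n ⊕ Fin n) (hi : i ≠ Sum.inl k) :
    seedMutX x A k i = x i := by
  rcases i with i | i
  · have : i ≠ k := fun h => hi (by rw [h])
    simp [seedMutX, this]
  · rfl

theorem exch_map {n : ℕ} {ι : Type*} [Fintype ι] {R S : Type*} [CommRing R] [CommRing S]
    (e : R →+* S) (x : ι → R) (A : Matrix ι (Fin n) ℤ) (k : Fin n) :
    e (exch x A k) = exch (fun i => e (x i)) A k := by
  simp [exch, map_prod]

theorem exch_neg {n : ℕ} {ι : Type*} [Fintype ι] {R : Type*} [CommRing R]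
    (x : ι → R) (A : Matrix ι (Fin n) ℤ) (k : Fin n) :
    exch x (-A) k = exch x A k := by
  simp [exch, add_comm]

theorem seedMutX_neg {n : ℕ} (x : Fin n ⊕ Fin n → CField n)
    (A : Matrix (Fin n ⊕ Fin n) (Fin n) ℤ) (k : Fin n) : seedMutX x (-A) k = seedMutX x A k := by
  ext i
  by_cases hi : i = Sum.inl k
  · rw [hi, seedMutX_self, seedMutX_self, exch_neg]
  · rw [seedMutX_of_ne _ _ _ _ hi, seedMutX_of_ne _ _ _ _ hi]

theorem seedMutX_map {n : ℕ} (e : CField n →+* CField n) (x : Fin n ⊕ Fin n → CField n)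
    (A : Matrix (Fin n ⊕ Fin n) (Fin n) ℤ) (k : Fin n) :
    seedMutX (fun i => e (x i)) A k = fun i => e (seedMutX x A k i) := by
  ext i
  by_cases hi : i = Sum.inl k
  · rw [hi, seedMutX_self, seedMutX_self, map_mul, map_inv₀, exch_map]
  · rw [seedMutX_of_ne _ _ _ _ hi, seedMutX_of_ne _ _ _ _ hi]

theorem foldl_map {n : ℕ} (e : CField n →+* CField n) (L : List (Fin n)) :
    ∀ (x : Fin n ⊕ Fin n → CField n) (A : Matrix (Fin n ⊕ Fin n) (Fin n) ℤ),
    (L.foldl mutatePair ((fun i => e (x i)), A)).1 =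
      fun i => e ((L.foldl mutatePair (x, A)).1 i) := by
  induction L with
  | nil => intro x A; rfl
  | cons k L ih =>
    intro x A
    simp only [List.foldl_cons, mutatePair, seedMutX_map]
    exact ih _ _

theorem exch_congr_ne {n : ℕ} {R : Type*} [CommRing R] {x x' : Fin n ⊕ Fin n → R}
    {A : Matrix (Fin n ⊕ Fin n) (Fin n) ℤ} {k : Fin n} (hA : A (Sum.inl k) k = 0)
    (h : ∀ i, i ≠ Sum.inl k → x i = x' i) : exch x A k = exch x' A k := by
  unfold exch
  congr 1
  · refine Finset.prod_congr rfl fun i _ => ?_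
    by_cases hi : i = Sum.inl k
    · rw [hi, hA]; simp
    · rw [h i hi]
  · refine Finset.prod_congr rfl fun i _ => ?_
    by_cases hi : i = Sum.inl k
    · rw [hi, hA]; simp
    · rw [h i hi]

theorem mutatePair_mutatePair {n : ℕ} {x : Fin n ⊕ Fin n → CField n}
    {A : Matrix (Fin n ⊕ Fin n) (Fin n) ℤ} {k : Fin n} (hA : A (Sum.inl k) k = 0)
    (hP : exch x A k ≠ 0) : mutatePair (mutatePair (x, A) k) k = (x, A) := by
  unfold mutatePair
  simp only [matMutate_matMutate, Prod.mk.injEq, and_true]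
  ext i
  by_cases hi : i = Sum.inl k
  · rw [hi, seedMutX_self, seedMutX_self]
    have : exch (seedMutX x A k) (matMutate Sum.inl A k) k = exch x A k := by
      rw [← exch_neg x A]
      have h2 : exch (seedMutX x A k) (matMutate Sum.inl A k) k = exch (seedMutX x A k) (-A) k := by
        simp [exch, matMutate_col]
      rw [h2]
      refine exch_congr_ne (by simp [hA]) fun i hi => seedMutX_of_ne _ _ _ _ hi
    rw [this]
    field_simp
  · rw [seedMutX_of_ne _ _ _ _ hi, seedMutX_of_ne _ _ _ _ hi]

/-! ### The integral polynomial ring -/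

abbrev DRing (n : ℕ) : Type := MvPolynomial (Fin n ⊕ Fin n) ℤ

def toF (n : ℕ) : DRing n →+* CField n :=
  (algebraMap (MvPolynomial (Fin n ⊕ Fin n) ℚ) (CField n)).comp
    (MvPolynomial.map (Int.castRingHom ℚ))

theorem toF_injective (n : ℕ) : Function.Injective (toF n) :=
  (IsFractionRing.injective (MvPolynomial (Fin n ⊕ Fin n) ℚ) (CField n)).comp
    (MvPolynomial.map_injective _ (RingHom.injective_int _))

theorem toF_X {n : ℕ} (i : Fin n ⊕ Fin n) : toF n (MvPolynomial.X i) = initX n i := by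
  simp [toF, initX]

theorem toF_exch {n : ℕ} (A : Matrix (Fin n ⊕ Fin n) (Fin n) ℤ) (k : Fin n) :
    toF n (exch MvPolynomial.X A k) = exch (initX n) A k := by
  rw [exch_map]
  simp only [toF_X]

theorem exch_X_ne_zero {n : ℕ} (A : Matrix (Fin n ⊕ Fin n) (Fin n) ℤ) (k : Fin n) :
    exch (MvPolynomial.X : _ → DRing n) A k ≠ 0 := by
  intro h
  have := congrArg (MvPolynomial.eval (fun _ => (1 : ℤ))) h
  simp [exch] at this

theorem exch_initX_ne_zero {n : ℕ} (A : Matrix (Fin n ⊕ Fin n) (Fin n) ℤ) (k : Fin n) :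
    exch (initX n) A k ≠ 0 := by
  rw [← toF_exch]
  exact (map_ne_zero_iff _ (toF_injective n)).mpr (exch_X_ne_zero A k)

theorem initX_ne_zero {n : ℕ} (i : Fin n ⊕ Fin n) : initX n i ≠ 0 := by
  rw [← toF_X]
  exact (map_ne_zero_iff _ (toF_injective n)).mpr (MvPolynomial.X_ne_zero i)

theorem exists_toF_div {n : ℕ} (z : CField n) :
    ∃ a b : DRing n, b ≠ 0 ∧ z = toF n a / toF n b := by
  have key : ∀ f : MvPolynomial (Fin n ⊕ Fin n) ℚ, ∃ (a : DRing n) (m : ℤ), m ≠ 0 ∧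
      MvPolynomial.map (Int.castRingHom ℚ) a = MvPolynomial.C (m : ℚ) * f := by
    intro f
    induction f using MvPolynomial.induction_on with
    | C r =>
      refine ⟨MvPolynomial.C r.num, r.den, by exact_mod_cast r.den_nz, ?_⟩
      rw [MvPolynomial.map_C, ← MvPolynomial.C_mul]
      congr 1
      have := Rat.den_mul_eq_num r
      simp [this]
    | add p q hp hq =>
      obtain ⟨a, m, hm, h1⟩ := hp
      obtain ⟨b, l, hl, h2⟩ := hq
      refine ⟨MvPolynomial.C l * a + MvPolynomial.C m * b, m * l, mul_ne_zero hm hl, ?_⟩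
      simp only [map_add, map_mul, MvPolynomial.map_C, h1, h2]
      push_cast
      simp only [map_mul, eq_intCast]
      ring
    | mul_X p i hp =>
      obtain ⟨a, m, hm, h1⟩ := hp
      refine ⟨a * MvPolynomial.X i, m, hm, ?_⟩
      simp only [map_mul, MvPolynomial.map_X, h1]
      ring
  obtain ⟨f, g, hg, rfl⟩ := IsFractionRing.div_surjective (A := MvPolynomial (Fin n ⊕ Fin n) ℚ) z
  obtain ⟨a, m, hm, h1⟩ := key f
  obtain ⟨b, l, hl, h2⟩ := key g
  have hg0 : g ≠ 0 := nonZeroDivisors.ne_zero hg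
  have hinj := IsFractionRing.injective (MvPolynomial (Fin n ⊕ Fin n) ℚ) (CField n)
  have hCC : ∀ r : ℤ, r ≠ 0 → algebraMap (MvPolynomial (Fin n ⊕ Fin n) ℚ) (CField n)
      (MvPolynomial.C (r : ℚ)) ≠ 0 := fun r hr => by
    rw [map_ne_zero_iff _ hinj, Ne, MvPolynomial.C_eq_zero]
    exact_mod_cast hr
  have hg1 := (map_ne_zero_iff _ hinj).mpr hg0
  have hb1 : toF n b = algebraMap (MvPolynomial (Fin n ⊕ Fin n) ℚ) (CField n)
      (MvPolynomial.C (l : ℚ)) * algebraMap _ _ g := by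
    rw [← map_mul, ← h2]; rfl
  have ha1 : toF n a = algebraMap (MvPolynomial (Fin n ⊕ Fin n) ℚ) (CField n)
      (MvPolynomial.C (m : ℚ)) * algebraMap _ _ f := by
    rw [← map_mul, ← h1]; rfl
  refine ⟨MvPolynomial.C l * a, MvPolynomial.C m * b, ?_, ?_⟩
  · refine mul_ne_zero ?_ ?_
    · rwa [Ne, MvPolynomial.C_eq_zero]
    · intro h
      rw [h, map_zero] at hb1
      exact mul_ne_zero (hCC l hl) hg1 hb1.symm
  · have hc : ∀ r : ℤ, toF n (MvPolynomial.C r) = algebraMap (MvPolynomial (Fin n ⊕ Fin n) ℚ)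
        (CField n) (MvPolynomial.C (r : ℚ)) := fun r => by
      simp [toF]
    have h3 := hCC m hm
    have h4 := hCC l hl
    rw [map_mul, map_mul, ha1, hb1, hc, hc]
    rw [div_eq_div_iff hg1 (mul_ne_zero h3 (mul_ne_zero h4 hg1))]
    ring

theorem exists_reduced {n : ℕ} (z : CField n) :
    ∃ a b : DRing n, b ≠ 0 ∧ z = toF n a / toF n b ∧ ∀ d, Prime d → d ∣ a → d ∣ b → False := by
  obtain ⟨a, b, hb, rfl⟩ := exists_toF_div z
  obtain ⟨a', b', c', h1, h2, h3⟩ := UniqueFactorizationMonoid.exists_reduced_factors' a b hb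
  subst h2 h3
  have hc : c' ≠ 0 := left_ne_zero_of_mul hb
  have hb' : b' ≠ 0 := right_ne_zero_of_mul hb
  refine ⟨a', b', hb', ?_, fun d hd ha hb => hd.not_isUnit (h1 ha hb)⟩
  rw [map_mul, map_mul, mul_div_mul_left]
  exact (map_ne_zero_iff _ (toF_injective n)).mpr hc

/-! ### Field homomorphisms from generating tuples -/

theorem exists_hom {n : ℕ} (x : Fin n ⊕ Fin n → CField n)
    (h : ∀ i, initX n i ∈ IntermediateField.adjoin ℚ (Set.range x)) :
    ∃ e : CField n →+* CField n, ∀ i, e (initX n i) = x i := by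
  have hinj := IsFractionRing.injective (MvPolynomial (Fin n ⊕ Fin n) ℚ) (CField n)
  have htop : ∀ z : CField n, z ∈ IntermediateField.adjoin ℚ (Set.range x) := by
    have hp : ∀ f : MvPolynomial (Fin n ⊕ Fin n) ℚ,
        algebraMap _ (CField n) f ∈ IntermediateField.adjoin ℚ (Set.range x) := by
      intro f
      induction f using MvPolynomial.induction_on with
      | C r =>
        have : algebraMap (MvPolynomial (Fin n ⊕ Fin n) ℚ) (CField n) (MvPolynomial.C r) =
          algebraMap ℚ (CField n) r := by
          rw [IsScalarTower.algebraMap_apply ℚ (MvPolynomial (Fin n ⊕ Fin n) ℚ) (CField n)]; rfl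
        rw [this]
        exact IntermediateField.algebraMap_mem _ _
      | add p q hp hq => rw [map_add]; exact add_mem hp hq
      | mul_X p i hp => rw [map_mul]; exact mul_mem hp (h i)
    intro z
    obtain ⟨f, g, hg, rfl⟩ := IsFractionRing.div_surjective (A := MvPolynomial (Fin n ⊕ Fin n) ℚ) z
    exact div_mem (hp f) (hp g)
  have halg : Algebra.IsAlgebraic (Algebra.adjoin ℚ (Set.range x)) (CField n) := by
    refine ⟨fun z => ?_⟩
    obtain ⟨r, hr, s, hs, rfl⟩ := IntermediateField.mem_adjoin_iff_div.mp (htop z)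
    rw [div_eq_mul_inv]
    exact (isAlgebraic_algebraMap (⟨r, hr⟩ : Algebra.adjoin ℚ (Set.range x))).mul
      (isAlgebraic_algebraMap (⟨s, hs⟩ : Algebra.adjoin ℚ (Set.range x))).inv
  have hle : Cardinal.mk (Fin n ⊕ Fin n) ≤ Algebra.trdeg ℚ (CField n) := by
    have h1 : AlgebraicIndependent ℚ (initX n) := by
      have := (MvPolynomial.algebraicIndependent_X (Fin n ⊕ Fin n) ℚ).map'
        (f := IsScalarTower.toAlgHom ℚ (MvPolynomial (Fin n ⊕ Fin n) ℚ) (CField n)) hinj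
      exact this
    exact h1.cardinalMk_le_trdeg
  have hb := Algebra.IsAlgebraic.isTranscendenceBasis_of_le_trdeg_of_finite ℚ x hle
  have hi : Function.Injective (MvPolynomial.aeval (R := ℚ) x) := hb.1
  refine ⟨IsFractionRing.lift (A := MvPolynomial (Fin n ⊕ Fin n) ℚ)
    (g := (MvPolynomial.aeval (R := ℚ) x).toRingHom) hi, fun i => ?_⟩
  rw [initX, IsFractionRing.lift_algebraMap]
  exact MvPolynomial.aeval_X _ _

theorem exists_hom_mut {n : ℕ} {A : Matrix (Fin n ⊕ Fin n) (Fin n) ℤ} {k : Fin n}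
    (hA : A (Sum.inl k) k = 0) :
    ∃ e : CField n →+* CField n, (fun i => e (initX n i)) = seedMutX (initX n) A k := by
  suffices hk : ∀ i, initX n i ∈
      IntermediateField.adjoin ℚ (Set.range (seedMutX (initX n) A k)) by
    obtain ⟨e, he⟩ := exists_hom (seedMutX (initX n) A k) hk
    exact ⟨e, funext he⟩
  · intro i
    set K := IntermediateField.adjoin ℚ (Set.range (seedMutX (initX n) A k))
    have h0 : ∀ i, seedMutX (initX n) A k i ∈ K := fun i =>
      IntermediateField.subset_adjoin _ _ (Set.mem_range_self i)
    have h1 : ∀ i, i ≠ Sum.inl k → initX n i ∈ K := fun i hi => by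
      rw [← seedMutX_of_ne (initX n) A k i hi]; exact h0 i
    by_cases hi : i = Sum.inl k
    · rw [hi]
      have h2 : exch (initX n) A k ∈ K := by
        rw [exch_congr_ne (x' := seedMutX (initX n) A k) hA
          fun i hi => (seedMutX_of_ne _ _ _ _ hi).symm]
        exact add_mem (prod_mem fun i _ => pow_mem (h0 i) _) (prod_mem fun i _ => pow_mem (h0 i) _)
      have h3 : initX n (Sum.inl k) = exch (initX n) A k / seedMutX (initX n) A k (Sum.inl k) := by
        rw [seedMutX_self]
        have := exch_initX_ne_zero A k
        have := initX_ne_zero (n := n) (Sum.inl k)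
        field_simp
      rw [h3]
      exact div_mem h2 (h0 _)
    · exact h1 i hi

def IsSeedX {n : ℕ} (x : Fin n ⊕ Fin n → CField n) : Prop :=
  ∃ e : CField n →+* CField n, (fun i => e (initX n i)) = x

theorem IsSeedX.mutate {n : ℕ} {x : Fin n ⊕ Fin n → CField n} (h : IsSeedX x)
    {A : Matrix (Fin n ⊕ Fin n) (Fin n) ℤ} {k : Fin n} (hA : A (Sum.inl k) k = 0) :
    IsSeedX (seedMutX x A k) := by
  obtain ⟨e, rfl⟩ := h
  obtain ⟨e', h'⟩ := exists_hom_mut hA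
  refine ⟨e.comp e', ?_⟩
  rw [seedMutX_map, ← h']
  rfl

theorem IsSeedX.exch_ne_zero {n : ℕ} {x : Fin n ⊕ Fin n → CField n} (h : IsSeedX x)
    (A : Matrix (Fin n ⊕ Fin n) (Fin n) ℤ) (k : Fin n) : exch x A k ≠ 0 := by
  obtain ⟨e, rfl⟩ := h
  rw [← exch_map]
  exact (map_ne_zero e).mpr (exch_initX_ne_zero A k)

theorem IsSeedX.ne_zero {n : ℕ} {x : Fin n ⊕ Fin n → CField n} (h : IsSeedX x)
    (i : Fin n ⊕ Fin n) : x i ≠ 0 := by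
  obtain ⟨e, rfl⟩ := h
  exact (map_ne_zero e).mpr (initX_ne_zero i)

theorem IsSeedX.init (n : ℕ) : IsSeedX (initX n) := ⟨RingHom.id _, rfl⟩


/-! ### The valuation ring of a prime -/

def primeVal {n : ℕ} (d : DRing n) (hd : Prime d) : ValuationSubring (CField n) where
  carrier := {z | ∃ a b : DRing n, ¬ d ∣ b ∧ z = toF n a / toF n b}
  mul_mem' := by
    rintro _ _ ⟨a, b, hb, rfl⟩ ⟨a', b', hb', rfl⟩
    refine ⟨a * a', b * b', fun h => (hd.dvd_or_dvd h).elim hb hb', ?_⟩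
    rw [map_mul, map_mul, div_mul_div_comm]
  one_mem' := ⟨1, 1, fun h => hd.not_isUnit (isUnit_of_dvd_one h), by simp⟩
  add_mem' := by
    rintro _ _ ⟨a, b, hb, rfl⟩ ⟨a', b', hb', rfl⟩
    refine ⟨a * b' + b * a', b * b', fun h => (hd.dvd_or_dvd h).elim hb hb', ?_⟩
    have h1 : toF n b ≠ 0 := (map_ne_zero_iff _ (toF_injective n)).mpr
      fun h => hb (h ▸ dvd_zero d)
    have h2 : toF n b' ≠ 0 := (map_ne_zero_iff _ (toF_injective n)).mpr
      fun h => hb' (h ▸ dvd_zero d)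
    rw [div_add_div _ _ h1 h2]
    simp only [map_mul, map_add]
  zero_mem' := ⟨0, 1, fun h => hd.not_isUnit (isUnit_of_dvd_one h), by simp⟩
  neg_mem' := by
    rintro _ ⟨a, b, hb, rfl⟩
    exact ⟨-a, b, hb, by rw [map_neg, neg_div]⟩
  mem_or_inv_mem' := by
    intro z
    obtain ⟨a, b, hb, rfl, h⟩ := exists_reduced z
    by_cases hdb : d ∣ b
    · right
      exact ⟨b, a, fun ha => h d hd ha hdb, by rw [inv_div]⟩
    · left
      exact ⟨a, b, hdb, rfl⟩

theorem mem_primeVal {n : ℕ} {d : DRing n} {hd : Prime d} {z : CField n} :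
    z ∈ primeVal d hd ↔ ∃ a b : DRing n, ¬ d ∣ b ∧ z = toF n a / toF n b := Iff.rfl

theorem primeVal_toF_le {n : ℕ} {d : DRing n} {hd : Prime d} (f : DRing n) :
    (primeVal d hd).valuation (toF n f) ≤ 1 := by
  rw [ValuationSubring.valuation_le_one_iff, mem_primeVal]
  exact ⟨f, 1, fun h => hd.not_isUnit (isUnit_of_dvd_one h), by simp⟩

theorem primeVal_toF_eq {n : ℕ} {d : DRing n} {hd : Prime d} {f : DRing n} (hf : ¬ d ∣ f) :
    (primeVal d hd).valuation (toF n f) = 1 := by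
  refine le_antisymm (primeVal_toF_le f) ?_
  have h0 : toF n f ≠ 0 := (map_ne_zero_iff _ (toF_injective n)).mpr
      fun h => hf (h ▸ dvd_zero d)
  have : (primeVal d hd).valuation (toF n f)⁻¹ ≤ 1 := by
    rw [ValuationSubring.valuation_le_one_iff, mem_primeVal]
    exact ⟨1, f, hf, by simp⟩
  rw [map_inv₀] at this
  exact (inv_le_one₀ (zero_lt_iff.mpr ((Valuation.ne_zero_iff _).mpr h0))).mp this

theorem primeVal_toF_lt {n : ℕ} {d : DRing n} {hd : Prime d} {f : DRing n} (hf : d ∣ f) :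
    (primeVal d hd).valuation (toF n f) < 1 := by
  obtain ⟨g, rfl⟩ := hf
  have h1 : (primeVal d hd).valuation (toF n d) < 1 := by
    refine lt_of_le_of_ne (primeVal_toF_le d) fun h => ?_
    have h2 : (primeVal d hd).valuation (toF n d)⁻¹ ≤ 1 := by rw [map_inv₀, h, inv_one]
    rw [ValuationSubring.valuation_le_one_iff, mem_primeVal] at h2
    obtain ⟨a, b, hb, hab⟩ := h2
    have hd0 : toF n d ≠ 0 := (map_ne_zero_iff _ (toF_injective n)).mpr hd.ne_zero
    have hb0 : toF n b ≠ 0 := (map_ne_zero_iff _ (toF_injective n)).mpr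
      fun h => hb (h ▸ dvd_zero d)
    have : toF n b = toF n (d * a) := by
      rw [map_mul]
      field_simp at hab
      linear_combination hab
    exact hb ⟨a, toF_injective n this⟩
  rw [map_mul, map_mul]
  exact mul_lt_one_of_lt_of_le h1 (primeVal_toF_le g)

theorem dvd_of_primeVal_lt {n : ℕ} {d : DRing n} {hd : Prime d} {f : DRing n}
    (h : (primeVal d hd).valuation (toF n f) < 1) : d ∣ f := by
  by_contra hc
  rw [primeVal_toF_eq hc] at h
  exact lt_irrefl _ h

/-! ### Laurent subring -/

def LauSet (n : ℕ) : Set (CField n) :=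
  {z | (∃ i, z = initX n i) ∨ ∃ i, z = (initX n (Sum.inl i))⁻¹}

def Lau (n : ℕ) : Subring (CField n) := Subring.closure (LauSet n)

theorem initX_mem_Lau {n : ℕ} (i : Fin n ⊕ Fin n) : initX n i ∈ Lau n :=
  Subring.subset_closure (Or.inl ⟨i, rfl⟩)

theorem inv_mem_Lau {n : ℕ} (i : Fin n) : (initX n (Sum.inl i))⁻¹ ∈ Lau n :=
  Subring.subset_closure (Or.inr ⟨i, rfl⟩)

theorem toF_mem_Lau {n : ℕ} (f : DRing n) : toF n f ∈ Lau n := by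
  induction f using MvPolynomial.induction_on with
  | C r => 
    have : toF n (MvPolynomial.C r) = (r : CField n) := by simp [toF]
    rw [this]
    exact intCast_mem _ r
  | add p q hp hq => rw [map_add]; exact add_mem hp hq
  | mul_X p i hp => rw [map_mul, toF_X]; exact mul_mem hp (initX_mem_Lau i)

theorem mem_Lau_of_primes {n : ℕ} {z : CField n}
    (h : ∀ (d : DRing n) (hd : Prime d), (∀ i : Fin n, ¬ d ∣ MvPolynomial.X (Sum.inl i)) →
      (primeVal d hd).valuation z ≤ 1) : z ∈ Lau n := by
  obtain ⟨a, b, hb, rfl, hab⟩ := exists_reduced z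
  have h1 : ∀ d, Prime d → d ∣ b → ∃ i : Fin n, d ∣ MvPolynomial.X (Sum.inl i) := by
    intro d hd hdb
    by_contra hc
    push Not at hc
    have h2 := h d hd hc
    have ha : ¬ d ∣ a := fun ha => hab d hd ha hdb
    rw [map_div₀, primeVal_toF_eq ha, one_div] at h2
    have h3 := primeVal_toF_lt (hd := hd) hdb
    have h0 : toF n b ≠ 0 := (map_ne_zero_iff _ (toF_injective n)).mpr hb
    have h4 := (inv_le_one₀ (zero_lt_iff.mpr ((Valuation.ne_zero_iff _).mpr h0))).mp h2
    exact absurd h3 (not_lt.mpr h4)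
  have h2 : (toF n b)⁻¹ ∈ Lau n := by
    clear hab h
    induction b using UniqueFactorizationMonoid.induction_on_prime with
    | h₁ => exact absurd rfl hb
    | h₂ x hx =>
      obtain ⟨u, rfl⟩ := hx
      have : (toF n (u : DRing n))⁻¹ = toF n ((u⁻¹ : (DRing n)ˣ) : DRing n) := by
        rw [inv_eq_iff_eq_inv, eq_comm, inv_eq_iff_eq_inv]
        refine eq_inv_of_mul_eq_one_left ?_
        rw [← map_mul]; simp
      rw [this]
      exact toF_mem_Lau _
    | h₃ a p ha hp ih =>
      rw [map_mul, mul_inv]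
      refine mul_mem ?_ (ih ha fun d hd hda => h1 d hd (hda.mul_left p))
      obtain ⟨i, q, hq⟩ := h1 p hp (dvd_mul_right p a)
      have hp0 : toF n p ≠ 0 := (map_ne_zero_iff _ (toF_injective n)).mpr hp.ne_zero
      have h3 : initX n (Sum.inl i) = toF n p * toF n q := by rw [← map_mul, ← hq, toF_X]
      have h4 : (toF n p)⁻¹ = toF n q * (initX n (Sum.inl i))⁻¹ := by
        have h5 := initX_ne_zero (n := n) (Sum.inl i)
        rw [h3] at h5 ⊢
        have := right_ne_zero_of_mul h5
        field_simp
      rw [h4]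
      exact mul_mem (toF_mem_Lau _) (inv_mem_Lau i)
  rw [div_eq_mul_inv]
  exact mul_mem (toF_mem_Lau a) h2

theorem val_le_of_mem_Lau {n : ℕ} {d : DRing n} {hd : Prime d} (e : CField n →+* CField n)
    (h1 : ∀ i : Fin n, (primeVal d hd).valuation (e (initX n (Sum.inl i))) = 1)
    (h2 : ∀ i : Fin n, (primeVal d hd).valuation (e (initX n (Sum.inr i))) ≤ 1)
    {z : CField n} (hz : z ∈ Lau n) : (primeVal d hd).valuation (e z) ≤ 1 := by
  rw [ValuationSubring.valuation_le_one_iff]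
  have : Lau n ≤ (primeVal d hd).toSubring.comap e := by
    rw [Lau, Subring.closure_le]
    rintro z (⟨i | i, rfl⟩ | ⟨i, rfl⟩)
    · exact ((primeVal d hd).valuation_le_one_iff _).mp (h1 i).le
    · exact ((primeVal d hd).valuation_le_one_iff _).mp (h2 i)
    · refine ((primeVal d hd).valuation_le_one_iff (e _)).mp ?_
      rw [map_inv₀, map_inv₀, h1, inv_one]
  exact this hz

/-! ### Coprimality via derivations -/

section deriv
set_option linter.unusedSectionVars false
open MvPolynomial

variable {ι : Type*} [Fintype ι] [DecidableEq ι]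

def mon (a : ι → ℕ) : MvPolynomial ι ℤ := ∏ i, X i ^ a i

def logDer (v : ι → ℤ) : Derivation ℤ (MvPolynomial ι ℤ) (MvPolynomial ι ℤ) :=
  mkDerivation ℤ (fun i => C (v i) * X i)

theorem logDer_mon (v : ι → ℤ) (a : ι → ℕ) :
    logDer v (mon a) = C (∑ i, v i * a i) * mon a := by
  unfold mon
  have hpow : ∀ (i : ι) (m : ℕ), logDer v (X i ^ m : MvPolynomial ι ℤ) = C (v i * m) * X i ^ m := by
    intro i m
    rw [Derivation.leibniz_pow]
    rcases m with _ | m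
    · simp
    · simp only [logDer, mkDerivation_X, smul_eq_mul, nsmul_eq_mul, map_mul, Nat.add_sub_cancel]
      simp
      ring
  suffices h : ∀ s : Finset ι, logDer v (∏ i ∈ s, X i ^ a i : MvPolynomial ι ℤ) =
      C (∑ i ∈ s, v i * a i) * ∏ i ∈ s, X i ^ a i from h _
  intro s
  induction s using Finset.induction_on with
  | empty => simp
  | insert i s hi ih =>
    rw [Finset.prod_insert hi, Finset.sum_insert hi, Derivation.leibniz, ih, hpow]
    simp only [smul_eq_mul, map_add]
    ring

theorem logDer_C (v : ι → ℤ) (c : ℤ) : logDer v (C c : MvPolynomial ι ℤ) = 0 := by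
  exact (logDer v).map_algebraMap c

theorem not_dvd_mon {d : MvPolynomial ι ℤ} (hd : Prime d) (hX : ∀ i, ¬ d ∣ X i) (a : ι → ℕ) :
    ¬ d ∣ mon a := by
  intro h
  obtain ⟨i, _, hi⟩ := hd.exists_mem_finset_dvd h
  exact hX i (hd.dvd_of_dvd_pow hi)

theorem mon_eq_monomial (a : ι → ℕ) : mon a = monomial (Finsupp.equivFunOnFinite.symm a) 1 := by
  unfold mon
  rw [monomial_eq]
  simp [Finsupp.prod_fintype]

theorem not_dvd_C {d : MvPolynomial ι ℤ} (hd : Prime d) {a b : ι → ℕ} (hab : a ≠ b)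
    (h : d ∣ mon a + mon b) {c : ℤ} (hc : c ≠ 0) : ¬ d ∣ C c := by
  rintro ⟨q, hq⟩
  have hq0 : q ≠ 0 := by
    rintro rfl
    rw [mul_zero, C_eq_zero] at hq
    exact hc hq
  have h1 := totalDegree_mul_of_isDomain hd.ne_zero hq0
  rw [← hq, totalDegree_C] at h1
  have h2 : d.totalDegree = 0 := by omega
  rw [totalDegree_eq_zero_iff_eq_C] at h2
  rw [h2, C_dvd_iff_dvd_coeff] at h
  have h3 := h (Finsupp.equivFunOnFinite.symm a)
  rw [mon_eq_monomial, mon_eq_monomial, coeff_add, coeff_monomial, coeff_monomial, if_pos rfl,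
    if_neg (by simpa using hab.symm), add_zero] at h3
  apply hd.not_isUnit
  rw [h2]
  exact (isUnit_of_dvd_one h3).map C

theorem logDer_binom (v : ι → ℤ) (a b : ι → ℕ) (c : ℤ) :
    logDer v (mon a + C c * mon b) = C (∑ i, v i * a i) * (mon a + C c * mon b) +
      C (c * (∑ i, v i * ((b i : ℤ) - a i))) * mon b := by
  rw [map_add, Derivation.leibniz, logDer_C, logDer_mon, logDer_mon]
  simp only [mul_sub, Finset.sum_sub_distrib, map_mul, map_sub, smul_eq_mul]
  ring

theorem logDer_binom' (v : ι → ℤ) (a b : ι → ℕ) :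
    logDer v (mon a + mon b) = C (∑ i, v i * a i) * (mon a + mon b) +
      C (∑ i, v i * ((b i : ℤ) - a i)) * mon b := by
  have := logDer_binom v a b 1
  simpa using this

theorem coprime_binom {d : MvPolynomial ι ℤ} (hd : Prime d) (hX : ∀ i, ¬ d ∣ X i)
    {a b a' b' : ι → ℕ} (hab : a ≠ b) (h : d ∣ mon a + mon b) {c : ℤ} (hc : c ≠ 0)
    (h' : d ∣ mon a' + C c * mon b') (v : ι → ℤ) (hv : ∑ i, v i * ((b i : ℤ) - a i) = 0) :
    ∑ i, v i * ((b' i : ℤ) - a' i) = 0 := by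
  have hC : ∀ (c : ℤ) (e : ι → ℕ), d ∣ C c * mon e → c = 0 := by
    intro c e hh
    by_contra hc
    rcases hd.dvd_or_dvd hh with h1 | h1
    · exact not_dvd_C hd hab h hc h1
    · exact not_dvd_mon hd hX e h1
  obtain ⟨q, hq⟩ := h
  -- d does not divide q
  have hdq : ¬ d ∣ q := by
    rintro ⟨r, rfl⟩
    obtain ⟨i, hi⟩ := Function.ne_iff.mp hab
    have h1 := logDer_binom' (Pi.single i 1) a b
    have h2 : d ∣ logDer (Pi.single i 1) (mon a + mon b) := by
      rw [hq, Derivation.leibniz, Derivation.leibniz]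
      simp only [smul_eq_mul]
      exact dvd_add (dvd_mul_right _ _) ((dvd_mul_right d r).mul_right _)
    rw [h1, hq] at h2
    have h3 := (dvd_add_right ((dvd_mul_right d (d * r)).mul_left _)).mp h2
    have h4 := hC _ _ h3
    have h5 : ∑ j, (Pi.single i 1 : ι → ℤ) j * ((b j : ℤ) - a j) = (b i : ℤ) - a i := by
      rw [Finset.sum_eq_single i]
      · simp
      · intro j _ hj; simp [hj]
      · simp
    rw [h5] at h4
    exact hi (by omega)
  have hdd : d ∣ logDer v d := by
    have h1 := logDer_binom' v a b
    rw [hv, map_zero, zero_mul, add_zero, hq, Derivation.leibniz] at h1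
    simp only [smul_eq_mul] at h1
    have h2 : d ∣ q * logDer v d :=
      ⟨C (∑ i, v i * a i) * q - logDer v q, by linear_combination h1⟩
    exact (hd.dvd_or_dvd h2).resolve_left hdq
  obtain ⟨r, hr⟩ := h'
  have h1 := logDer_binom v a' b' c
  have h2 : d ∣ logDer v (mon a' + C c * mon b') := by
    rw [hr, Derivation.leibniz]
    simp only [smul_eq_mul]
    exact dvd_add (dvd_mul_right _ _) (hdd.mul_left _)
  rw [h1, hr] at h2
  have h3 := hC _ _ ((dvd_add_right ((dvd_mul_right d r).mul_left _)).mp h2)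
  exact (mul_eq_zero.mp h3).resolve_left hc

theorem X_not_dvd {d : MvPolynomial ι ℤ} (hd : Prime d) {a b : ι → ℕ}
    (hab : ∀ i, a i = 0 ∨ b i = 0) (h : d ∣ mon a + mon b) (i : ι) : ¬ d ∣ X i := by
  intro hi
  have hX : d ∣ X i ∧ X i ∣ d := by
    refine ⟨hi, ?_⟩
    exact (hd.associated_of_dvd X_prime hi).symm.dvd
  have h1 : X i ∣ mon a + mon b := hX.2.trans h
  obtain ⟨q, hq⟩ := h1
  have := congrArg (eval (fun j => if j = i then (0 : ℤ) else 1)) hq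
  have hm : ∀ a : ι → ℕ, eval (fun j => if j = i then (0 : ℤ) else 1) (mon a) = 0 ^ a i := by
    intro a
    simp only [mon, map_prod, map_pow, eval_X]
    rw [Finset.prod_eq_single i]
    · simp
    · intro j _ hj; simp [hj]
    · simp
  rw [map_add, hm, hm, map_mul, eval_X, if_pos rfl, zero_mul] at this
  rcases hab i with h | h
  · rw [h, pow_zero] at this
    have : (0:ℤ) ≤ 0 ^ b i := by positivity
    omega
  · rw [h, pow_zero] at this
    have : (0:ℤ) ≤ 0 ^ a i := by positivity
    omega

end deriv


/-! ### Local analysis -/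

def yhat {n : ℕ} (x : Fin n ⊕ Fin n → CField n) (A : Matrix (Fin n ⊕ Fin n) (Fin n) ℤ)
    (k : Fin n) : CField n := ∏ i, x i ^ (A i k)

def negMon {n : ℕ} (x : Fin n ⊕ Fin n → CField n) (A : Matrix (Fin n ⊕ Fin n) (Fin n) ℤ)
    (k : Fin n) : CField n := ∏ i, x i ^ (-(A i k)).toNat

theorem pow_toNat_eq {n : ℕ} {x : CField n} (hx : x ≠ 0) (a : ℤ) :
    x ^ a.toNat = x ^ (-a).toNat * x ^ a := by
  rw [← zpow_natCast, ← zpow_natCast, ← zpow_add₀ hx]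
  congr 1
  omega

theorem exch_eq {n : ℕ} {x : Fin n ⊕ Fin n → CField n} (hx : ∀ i, x i ≠ 0)
    (A : Matrix (Fin n ⊕ Fin n) (Fin n) ℤ) (k : Fin n) :
    exch x A k = negMon x A k * (1 + yhat x A k) := by
  rw [mul_add, mul_one, negMon, yhat, ← Finset.prod_mul_distrib, exch, add_comm]
  congr 1
  exact Finset.prod_congr rfl fun i _ => pow_toNat_eq (hx i) _

theorem negMon_ne_zero {n : ℕ} {x : Fin n ⊕ Fin n → CField n} (hx : ∀ i, x i ≠ 0)
    (A : Matrix (Fin n ⊕ Fin n) (Fin n) ℤ) (k : Fin n) : negMon x A k ≠ 0 :=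
  Finset.prod_ne_zero_iff.mpr fun i _ => pow_ne_zero _ (hx i)

theorem yhat_mut_self {n : ℕ} (x : Fin n ⊕ Fin n → CField n)
    {A : Matrix (Fin n ⊕ Fin n) (Fin n) ℤ} {k : Fin n} (hA : A (Sum.inl k) k = 0) :
    yhat (seedMutX x A k) (matMutate Sum.inl A k) k = (yhat x A k)⁻¹ := by
  unfold yhat
  rw [← Finset.prod_inv_distrib]
  refine Finset.prod_congr rfl fun i _ => ?_
  rw [matMutate_col]
  by_cases hi : i = Sum.inl k
  · rw [hi, hA]; simp
  · rw [seedMutX_of_ne _ _ _ _ hi, zpow_neg]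

theorem yhat_mut {n : ℕ} {x : Fin n ⊕ Fin n → CField n} (hx : ∀ i, x i ≠ 0)
    {A : Matrix (Fin n ⊕ Fin n) (Fin n) ℤ} {k : Fin n} (hA : A (Sum.inl k) k = 0)
    (hP : exch x A k ≠ 0) {j : Fin n} (hj : j ≠ k) :
    yhat (seedMutX x A k) (matMutate Sum.inl A k) j =
      yhat x A j * yhat x A k ^ (max (A (Sum.inl k) j) 0) *
        (1 + yhat x A k) ^ (-(A (Sum.inl k) j)) := by
  have hterm : ∀ i, (seedMutX x A k i) ^ (matMutate Sum.inl A k i j) =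
      x i ^ (A i j) * (x i ^ (A i k)) ^ (max (A (Sum.inl k) j) 0) *
        (x i ^ (-(A i k)).toNat) ^ (A (Sum.inl k) j) *
        (if i = Sum.inl k then exch x A k ^ (-(A (Sum.inl k) j)) else 1) := by
    intro i
    by_cases hi : i = Sum.inl k
    · subst hi
      rw [matMutate_row, seedMutX_self, hA, if_pos rfl, mul_zpow, inv_zpow, zpow_neg, inv_inv]
      simp
    · rw [if_neg hi, seedMutX_of_ne _ _ _ _ hi, matMutate_of_ne _ _ _ _ hi hj, mul_one,
        zpow_add₀ (hx i), zpow_add₀ (hx i), zpow_mul, zpow_mul]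
      congr 2
      rw [← Int.toNat_eq_max, zpow_natCast]
  have hM := negMon_ne_zero hx A k
  rw [exch_eq hx] at hP
  have hP' := right_ne_zero_of_mul hP
  rw [yhat, Finset.prod_congr rfl fun i _ => hterm i, Finset.prod_mul_distrib,
    Finset.prod_mul_distrib, Finset.prod_mul_distrib, Finset.prod_ite_eq' Finset.univ,
    if_pos (Finset.mem_univ _), Finset.prod_zpow, Finset.prod_zpow, exch_eq hx]
  change yhat x A j * yhat x A k ^ _ * negMon x A k ^ _ * _ = _
  rw [mul_zpow, mul_assoc, ← mul_assoc (negMon x A k ^ _), ← zpow_add₀ hM]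
  simp

theorem one_add_pow_eq {R : Type*} [CommRing R] (S : Subring R) {Y : R} (hY : Y ∈ S) (g : ℕ) :
    ∃ r ∈ S, (1 + Y) ^ g = 1 + g * Y + Y ^ 2 * r := by
  induction g with
  | zero => exact ⟨0, S.zero_mem, by simp⟩
  | succ g ih =>
    obtain ⟨r, hr, h⟩ := ih
    refine ⟨r + g + Y * r, add_mem (add_mem hr (natCast_mem _ _)) (mul_mem hY hr), ?_⟩
    rw [pow_succ, h]
    push_cast
    ring

theorem val_one_add {K : Type*} [Field K] (V : ValuationSubring K) {u y : K}
    (hu : V.valuation u = 1) (h : V.valuation y < 1) : V.valuation (u + y) = 1 := by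
  rw [V.valuation.map_add_eq_of_lt_left (by rwa [hu]), hu]

theorem local_lemma {n : ℕ} (V : ValuationSubring (CField n)) {x : Fin n ⊕ Fin n → CField n}
    (hs : IsSeedX x) {A : Matrix (Fin n ⊕ Fin n) (Fin n) ℤ} (hA : GoodMat A) {j k : Fin n}
    (hjk : j ≠ k) (hβ : A (Sum.inl j) k ≤ 0) (hv : ∀ i, V.valuation (x i) = 1)
    (hw : V.valuation (1 + yhat x A j) < 1)
    (H1 : A (Sum.inl j) k = 0 → V.valuation (1 + yhat x A k) = 1)
    (H2 : A (Sum.inl j) k = -1 → V.valuation (1 + (A (Sum.inl k) j : CField n) * yhat x A k) = 1)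
    {x1 x2 x3 : Fin n ⊕ Fin n → CField n} {A1 A2 : Matrix (Fin n ⊕ Fin n) (Fin n) ℤ}
    (hx1 : x1 = seedMutX x A j) (hA1 : A1 = matMutate Sum.inl A j)
    (hx2 : x2 = seedMutX x1 A1 k) (hA2 : A2 = matMutate Sum.inl A1 k)
    (hx3 : x3 = seedMutX x2 A2 j) :
    V.valuation (x2 (Sum.inl k)) = 1 ∧ V.valuation (x3 (Sum.inl j)) = 1 := by
  have hγ := hA.sign hβ
  have hs1 : IsSeedX x1 := hx1 ▸ hs.mutate (hA.diag j)
  have hg1 : GoodMat A1 := hA1 ▸ hA.mutate j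
  have hs2 : IsSeedX x2 := hx2 ▸ hs1.mutate (hg1.diag k)
  have hg2 : GoodMat A2 := hA2 ▸ hg1.mutate k
  have hvy : ∀ k, V.valuation (yhat x A k) = 1 := fun k => by
    simp [yhat, map_prod, hv]
  set w := 1 + yhat x A j with hwdef
  obtain ⟨b, hb⟩ : ∃ b : ℕ, A (Sum.inl j) k = -b := ⟨(-(A (Sum.inl j) k)).toNat, by omega⟩
  obtain ⟨g, hg⟩ : ∃ g : ℕ, A (Sum.inl k) j = g := ⟨(A (Sum.inl k) j).toNat, by omega⟩
  have hP := hs.exch_ne_zero A j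
  have hw0 : w ≠ 0 := by
    rw [exch_eq hs.ne_zero] at hP
    exact right_ne_zero_of_mul hP
  have hvw0 : V.valuation w ≠ 0 := (Valuation.ne_zero_iff _).mpr hw0
  have hY : yhat x1 A1 k = yhat x A k * w ^ b := by
    rw [hx1, hA1, yhat_mut hs.ne_zero (hA.diag j) hP hjk.symm, max_eq_right hβ, hb]
    simp [hwdef]
  set Y := yhat x1 A1 k with hYdef
  have hvY : V.valuation Y = V.valuation w ^ b := by rw [hY, map_mul, hvy, one_mul, map_pow]
  have hvYlt : b ≠ 0 → V.valuation Y < 1 := fun h => by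
    rw [hvY]; exact pow_lt_one₀ zero_le hw h
  have hv1Y : V.valuation (1 + Y) = 1 := by
    by_cases h : b = 0
    · rw [hY, h, pow_zero, mul_one]
      exact H1 (by rw [hb, h]; simp)
    · exact val_one_add V (map_one _) (hvYlt h)
  have hx1' : ∀ i, i ≠ Sum.inl j → x1 i = x i := fun i hi => by
    rw [hx1, seedMutX_of_ne _ _ _ _ hi]
  have hx2' : ∀ i, i ≠ Sum.inl k → x2 i = x1 i := fun i hi => by
    rw [hx2, seedMutX_of_ne _ _ _ _ hi]
  have hkj' : (Sum.inl k : Fin n ⊕ Fin n) ≠ Sum.inl j := by simpa using hjk.symm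
  have hx4 : V.valuation (x2 (Sum.inl k)) = 1 := by
    rw [hx2, seedMutX_self, exch_eq hs1.ne_zero, map_mul, map_mul, hv1Y, map_inv₀, hx1' _ hkj', hv,
      inv_one, one_mul, mul_one, negMon, map_prod]
    refine Finset.prod_eq_one fun i _ => ?_
    by_cases hi : i = Sum.inl j
    · rw [hi, hA1, matMutate_row, neg_neg, Int.toNat_of_nonpos hβ, pow_zero, map_one]
    · rw [hx1' _ hi, map_pow, hv, one_pow]
  refine ⟨hx4, ?_⟩
  have hvx3 : V.valuation (x1 (Sum.inl j)) = V.valuation w := by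
    rw [hx1, seedMutX_self, exch_eq hs.ne_zero, map_mul, map_mul, map_inv₀, hv, inv_one, one_mul]
    simp [negMon, map_prod, hv, hwdef]
  have hyj : yhat x2 A2 j = (yhat x A j)⁻¹ * (1 + Y) ^ g := by
    rw [hx2, hA2, yhat_mut hs1.ne_zero (hg1.diag k) (hs1.exch_ne_zero _ _) hjk]
    have h1 : A1 (Sum.inl k) j = -g := by rw [hA1, matMutate_col, hg]
    rw [h1, max_eq_right (by simp), hx1, hA1, yhat_mut_self _ (hA.diag j), ← hx1, ← hA1]
    simp [hYdef]
  have hyj0 : yhat x A j ≠ 0 := by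
    rw [← Valuation.ne_zero_iff V.valuation, hvy]; exact one_ne_zero
  have key : V.valuation (1 + yhat x2 A2 j) = V.valuation w := by
    have h1 : 1 + yhat x2 A2 j = (yhat x A j)⁻¹ * (w - 1 + (1 + Y) ^ g) := by
      rw [hyj, hwdef]
      field_simp
      ring
    rw [h1, map_mul, map_inv₀, hvy, inv_one, one_mul]
    rcases b with _ | b
    · have : A (Sum.inl k) j = 0 := hA.zero (by rw [hb]; simp)
      have : g = 0 := by omega
      rw [this, pow_zero, sub_add_cancel]
    · have hYlt := hvYlt (by simp)
      obtain ⟨r, hr, h2⟩ := one_add_pow_eq V.toSubring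
        ((V.valuation_le_one_iff _).mp hYlt.le : Y ∈ V) g
      have hr' : V.valuation r ≤ 1 := (V.valuation_le_one_iff _).mpr hr
      have hgv : V.valuation (g : CField n) ≤ 1 := (V.valuation_le_one_iff _).mpr (natCast_mem _ _)
      have hwb : V.valuation (w ^ b) ≤ 1 := by rw [map_pow]; exact pow_le_one₀ zero_le hw.le
      have h3 : w - 1 + (1 + Y) ^ g =
          w * ((1 + g * (yhat x A k * w ^ b)) + yhat x A k * w ^ b * (Y * r)) := by
        rw [h2, hY]; ring
      rw [h3, map_mul, val_one_add V (u := 1 + g * (yhat x A k * w ^ b)), mul_one]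
      · rcases b with _ | b
        · rw [pow_zero, mul_one]
          have := H2 (by rw [hb]; simp)
          rw [hg] at this
          simpa using this
        · refine val_one_add V (map_one _) ?_
          rw [map_mul, map_mul, hvy, one_mul, map_pow]
          exact (mul_comm _ _).trans_lt (mul_lt_one_of_lt_of_le (pow_lt_one₀ zero_le hw (by simp)) hgv)
      · rw [map_mul, map_mul, map_mul, hvy, one_mul]
        exact (mul_comm _ _).trans_lt (mul_lt_one_of_lt_of_le (mul_lt_one_of_lt_of_le hYlt hr') hwb)
  rw [hx3, seedMutX_self, exch_eq hs2.ne_zero, map_mul, map_mul, key, map_inv₀,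
    hx2' _ hkj'.symm, hvx3]
  have : V.valuation (negMon x2 A2 j) = 1 := by
    rw [negMon, map_prod]
    refine Finset.prod_eq_one fun i _ => ?_
    by_cases hi : i = Sum.inl j
    · rw [hi, hg2.diag]; simp
    · by_cases hi' : i = Sum.inl k
      · rw [hi', map_pow, hx4, one_pow]
      · rw [hx2' _ hi', hx1' _ hi, map_pow, hv, one_pow]
  rw [this, one_mul, inv_mul_cancel₀ hvw0]

/-! ### The local dichotomy and the Laurent phenomenon -/

def posE {n : ℕ} (A : Matrix (Fin n ⊕ Fin n) (Fin n) ℤ) (k : Fin n) : Fin n ⊕ Fin n → ℕ :=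
  fun i => (A i k).toNat

def negE {n : ℕ} (A : Matrix (Fin n ⊕ Fin n) (Fin n) ℤ) (k : Fin n) : Fin n ⊕ Fin n → ℕ :=
  fun i => (-(A i k)).toNat

theorem exch_X_eq {n : ℕ} (A : Matrix (Fin n ⊕ Fin n) (Fin n) ℤ) (k : Fin n) :
    exch (MvPolynomial.X : _ → DRing n) A k = mon (posE A k) + mon (negE A k) := rfl

theorem toF_binom {n : ℕ} (A : Matrix (Fin n ⊕ Fin n) (Fin n) ℤ) (k : Fin n) (c : ℤ) :
    toF n (mon (negE A k) + MvPolynomial.C c * mon (posE A k)) =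
      negMon (initX n) A k * (1 + (c : CField n) * yhat (initX n) A k) := by
  have h1 : toF n (mon (negE A k)) = negMon (initX n) A k := by
    simp only [mon, negMon, map_prod, map_pow, toF_X, negE]
  have h2 : toF n (mon (posE A k)) = negMon (initX n) A k * yhat (initX n) A k := by
    rw [negMon, yhat, ← Finset.prod_mul_distrib]
    simp only [mon, map_prod, map_pow, toF_X, posE]
    exact Finset.prod_congr rfl fun i _ => pow_toNat_eq (initX_ne_zero i) _
  have h3 : toF n (MvPolynomial.C c) = (c : CField n) := by simp [toF]
  rw [map_add, map_mul, h1, h2, h3]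
  ring

theorem posE_ne_negE {n : ℕ} {A : Matrix (Fin n ⊕ Fin n) (Fin n) ℤ} (hA : GoodMat A) (j : Fin n) :
    ∃ i, A i j ≠ 0 := by
  by_contra h
  push Not at h
  have := hA.inj (Pi.single j 1) fun i => by
    rw [Finset.sum_eq_single j]
    · simp [h]
    · intro b _ hb; simp [hb]
    · simp
  have := congrFun this j
  simp at this

theorem val_coprime {n : ℕ} {d : DRing n} (hd : Prime d) {A : Matrix (Fin n ⊕ Fin n) (Fin n) ℤ}
    (hA : GoodMat A) {j k : Fin n} (hdj : d ∣ exch MvPolynomial.X A j) {c : ℤ} (hc : c ≠ 0)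
    (hv : ∃ v : Fin n ⊕ Fin n → ℤ, ∑ i, v i * A i j = 0 ∧ ∑ i, v i * A i k ≠ 0) :
    (primeVal d hd).valuation (1 + (c : CField n) * yhat (initX n) A k) = 1 := by
  have hX : ∀ i, ¬ d ∣ MvPolynomial.X i := by
    rw [exch_X_eq] at hdj
    exact X_not_dvd hd (fun i => by simp only [posE, negE]; omega) hdj
  have hvx : ∀ i, (primeVal d hd).valuation (initX n i) = 1 := fun i => by
    rw [← toF_X]; exact primeVal_toF_eq (hX i)
  have hM : (primeVal d hd).valuation (negMon (initX n) A k) = 1 := by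
    simp [negMon, map_prod, hvx]
  have h1 := toF_binom A k c
  have h2 : (primeVal d hd).valuation (1 + (c : CField n) * yhat (initX n) A k) =
      (primeVal d hd).valuation (toF n (mon (negE A k) + MvPolynomial.C c * mon (posE A k))) := by
    rw [h1, map_mul, hM, one_mul]
  rw [h2]
  apply primeVal_toF_eq
  intro h
  obtain ⟨v, hv1, hv2⟩ := hv
  apply hv2
  rw [exch_X_eq] at hdj
  have hne : posE A j ≠ negE A j := by
    intro h
    obtain ⟨i, hi⟩ := posE_ne_negE hA j
    have := congrFun h i
    simp only [posE, negE] at this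
    omega
  have e1 : ∀ (i) (j : Fin n), ((negE A j i : ℤ) - posE A j i) = - A i j := fun i j => by
    simp only [posE, negE]; omega
  have e2 : ∀ (i) (j : Fin n), ((posE A j i : ℤ) - negE A j i) = A i j := fun i j => by
    simp only [posE, negE]; omega
  have := coprime_binom hd hX hne hdj hc h v (by
    simp only [e1, mul_neg, Finset.sum_neg_distrib, hv1, neg_zero])
  simpa only [e2] using this

theorem local_prime_aux {n : ℕ} {d : DRing n} (hd : Prime d)
    (hdx : ∀ i : Fin n, ¬ d ∣ MvPolynomial.X (Sum.inl i))
    {A : Matrix (Fin n ⊕ Fin n) (Fin n) ℤ} (hA : GoodMat A) {j k : Fin n}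
    (hjk : j ≠ k) (hβ : A (Sum.inl j) k ≤ 0)
    {x1 x2 x3 : Fin n ⊕ Fin n → CField n} {A1 A2 : Matrix (Fin n ⊕ Fin n) (Fin n) ℤ}
    (hx1 : x1 = seedMutX (initX n) A j) (hA1 : A1 = matMutate Sum.inl A j)
    (hx2 : x2 = seedMutX x1 A1 k) (hA2 : A2 = matMutate Sum.inl A1 k)
    (hx3 : x3 = seedMutX x2 A2 j) :
    (primeVal d hd).valuation (x1 (Sum.inl j)) = 1 ∨
    ((primeVal d hd).valuation (x2 (Sum.inl k)) = 1 ∧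
      (primeVal d hd).valuation (x3 (Sum.inl j)) = 1) := by
  by_cases hdj : d ∣ exch MvPolynomial.X A j
  · right
    have hX : ∀ i, ¬ d ∣ MvPolynomial.X i := by
      rw [exch_X_eq] at hdj
      exact X_not_dvd hd (fun i => by simp only [posE, negE]; omega) hdj
    have hvx : ∀ i, (primeVal d hd).valuation (initX n i) = 1 := fun i => by
      rw [← toF_X]; exact primeVal_toF_eq (hX i)
    have hM : (primeVal d hd).valuation (negMon (initX n) A j) = 1 := by
      simp [negMon, map_prod, hvx]
    have hw : (primeVal d hd).valuation (1 + yhat (initX n) A j) < 1 := by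
      have h1 := primeVal_toF_lt (hd := hd) hdj
      rwa [toF_exch, exch_eq initX_ne_zero, map_mul, hM, one_mul] at h1
    refine local_lemma (primeVal d hd) (IsSeedX.init n) hA hjk hβ hvx hw ?_ ?_
      hx1 hA1 hx2 hA2 hx3
    · intro h0
      have := val_coprime hd hA (k := k) hdj (one_ne_zero (α := ℤ)) ?_
      · simpa using this
      · obtain ⟨i, hi⟩ := posE_ne_negE hA j
        by_contra hc
        push Not at hc
        have h2 : ∀ l, A i j * A l k = A l j * A i k := by
          intro l
          have h3 := hc (fun m => A i j * (if m = l then 1 else 0) - A l j * (if m = i then 1 else 0))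
            (by simp [sub_mul, Finset.sum_sub_distrib]; ring)
          simp [sub_mul, Finset.sum_sub_distrib] at h3
          linarith
        have h4 := hA.inj (fun m => A i j * (if m = k then 1 else 0) -
          A i k * (if m = j then 1 else 0)) (fun l => by
            simp [mul_sub, Finset.sum_sub_distrib]
            linarith [h2 l, mul_comm (A l k) (A i j)])
        have h5 := congrFun h4 k
        simp [hjk.symm] at h5
        exact hi h5
    · intro h1
      refine val_coprime hd hA (k := k) hdj (fun h => ?_) ⟨Pi.single (Sum.inl j) 1, ?_, ?_⟩
      · have := hA.zero h; omega
      · simp [Pi.single_apply, hA.diag]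
      · simp [Pi.single_apply, h1]
  · left
    rw [hx1, seedMutX_self, ← toF_exch, map_mul, primeVal_toF_eq hdj, map_inv₀, ← toF_X,
      primeVal_toF_eq (hdx j), inv_one, mul_one]

theorem local_prime {n : ℕ} {d : DRing n} (hd : Prime d)
    (hdx : ∀ i : Fin n, ¬ d ∣ MvPolynomial.X (Sum.inl i))
    {A : Matrix (Fin n ⊕ Fin n) (Fin n) ℤ} (hA : GoodMat A) {j k : Fin n}
    (hjk : j ≠ k)
    {x1 x2 x3 : Fin n ⊕ Fin n → CField n} {A1 A2 : Matrix (Fin n ⊕ Fin n) (Fin n) ℤ}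
    (hx1 : x1 = seedMutX (initX n) A j) (hA1 : A1 = matMutate Sum.inl A j)
    (hx2 : x2 = seedMutX x1 A1 k) (hA2 : A2 = matMutate Sum.inl A1 k)
    (hx3 : x3 = seedMutX x2 A2 j) :
    (primeVal d hd).valuation (x1 (Sum.inl j)) = 1 ∨
    ((primeVal d hd).valuation (x2 (Sum.inl k)) = 1 ∧
      (primeVal d hd).valuation (x3 (Sum.inl j)) = 1) := by
  rcases le_total (A (Sum.inl j) k) 0 with h | h
  · exact local_prime_aux hd hdx hA hjk h hx1 hA1 hx2 hA2 hx3
  · refine local_prime_aux hd hdx hA.neg hjk (by simpa using h) (A1 := -A1) (A2 := -A2)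
      ?_ ?_ ?_ ?_ ?_
    · rw [seedMutX_neg, hx1]
    · rw [matMutate_neg, hA1]
    · rw [seedMutX_neg, hx2]
    · rw [matMutate_neg, hA2]
    · rw [seedMutX_neg, hx3]

theorem val_initX_le {n : ℕ} {d : DRing n} {hd : Prime d} (i : Fin n ⊕ Fin n) :
    (primeVal d hd).valuation (initX n i) ≤ 1 := by
  rw [← toF_X]; exact primeVal_toF_le _

theorem laurent {n : ℕ} : ∀ (N : ℕ) (L : List (Fin n)), L.length = N →
    ∀ (A : Matrix (Fin n ⊕ Fin n) (Fin n) ℤ), GoodMat A → ∀ i,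
    (L.foldl mutatePair (initX n, A)).1 i ∈ Lau n := by
  intro N
  induction N using Nat.strong_induction_on with
  | _ N ih =>
  intro L hL A hA i
  rcases L with _ | ⟨j, L⟩
  · exact initX_mem_Lau i
  rcases L with _ | ⟨k, L⟩
  · change seedMutX (initX n) A j i ∈ Lau n
    by_cases hi : i = Sum.inl j
    · rw [hi, seedMutX_self, ← toF_exch]
      exact mul_mem (inv_mem_Lau j) (toF_mem_Lau _)
    · rw [seedMutX_of_ne _ _ _ _ hi]
      exact initX_mem_Lau i
  simp only [List.length_cons] at hL
  by_cases hjk : j = k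
  · subst hjk
    rw [List.foldl_cons, List.foldl_cons,
      mutatePair_mutatePair (hA.diag j) (exch_initX_ne_zero A j)]
    exact ih L.length (by omega) L rfl A hA i
  obtain ⟨x1, hx1⟩ : ∃ x1, x1 = seedMutX (initX n) A j := ⟨_, rfl⟩
  obtain ⟨A1, hA1⟩ : ∃ A1, A1 = matMutate Sum.inl A j := ⟨_, rfl⟩
  obtain ⟨x2, hx2⟩ : ∃ x2, x2 = seedMutX x1 A1 k := ⟨_, rfl⟩
  obtain ⟨A2, hA2⟩ : ∃ A2, A2 = matMutate Sum.inl A1 k := ⟨_, rfl⟩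
  obtain ⟨x3, hx3⟩ : ∃ x3, x3 = seedMutX x2 A2 j := ⟨_, rfl⟩
  obtain ⟨A3, hA3⟩ : ∃ A3, A3 = matMutate Sum.inl A2 j := ⟨_, rfl⟩
  have hg1 : GoodMat A1 := hA1 ▸ hA.mutate j
  have hg2 : GoodMat A2 := hA2 ▸ hg1.mutate k
  have hg3 : GoodMat A3 := hA3 ▸ hg2.mutate j
  have hs1 : IsSeedX x1 := hx1 ▸ (IsSeedX.init n).mutate (hA.diag j)
  have hs2 : IsSeedX x2 := hx2 ▸ hs1.mutate (hg1.diag k)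
  have hs3 : IsSeedX x3 := hx3 ▸ hs2.mutate (hg2.diag j)
  have hx1' : ∀ i, i ≠ Sum.inl j → x1 i = initX n i := fun i hi => by
    rw [hx1, seedMutX_of_ne _ _ _ _ hi]
  have hx2' : ∀ i, i ≠ Sum.inl k → x2 i = x1 i := fun i hi => by
    rw [hx2, seedMutX_of_ne _ _ _ _ hi]
  have hx3' : ∀ i, i ≠ Sum.inl j → x3 i = x2 i := fun i hi => by
    rw [hx3, seedMutX_of_ne _ _ _ _ hi]
  have hL1 : ((j :: k :: L).foldl mutatePair (initX n, A)) =
      ((k :: L).foldl mutatePair (x1, A1)) := by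
    rw [List.foldl_cons, hx1, hA1]; rfl
  have hL3 : ((j :: k :: L).foldl mutatePair (initX n, A)) =
      ((j :: L).foldl mutatePair (x3, A3)) := by
    rw [hL1, List.foldl_cons, List.foldl_cons]
    congr 1
    have h1 : mutatePair (x1, A1) k = (x2, A2) := by rw [hx2, hA2]; rfl
    have h2 : (x3, A3) = mutatePair (x2, A2) j := by rw [hx3, hA3]; rfl
    rw [h2, mutatePair_mutatePair (hg2.diag j) (hs2.exch_ne_zero _ _), h1]
  apply mem_Lau_of_primes
  intro d hd hdx
  have hv0 : ∀ i, (primeVal d hd).valuation (initX n (Sum.inl i)) = 1 := fun i => by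
    rw [← toF_X]; exact primeVal_toF_eq (hdx i)
  rcases local_prime hd hdx hA hjk hx1 hA1 hx2 hA2 hx3 with h | ⟨h4, h5⟩
  · obtain ⟨e, he⟩ := hs1
    have he' := fun i => congrFun he i
    rw [hL1, ← he, foldl_map]
    refine val_le_of_mem_Lau e (fun l => ?_) (fun l => ?_)
      (ih (k :: L).length (by simp; omega) (k :: L) rfl A1 hg1 i)
    · rw [he']
      by_cases hl : l = j
      · rw [hl, h]
      · rw [hx1' _ (by simpa using hl), hv0]
    · rw [he', hx1' _ (by simp)]
      exact val_initX_le _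
  · obtain ⟨e, he⟩ := hs3
    have he' := fun i => congrFun he i
    rw [hL3, ← he, foldl_map]
    refine val_le_of_mem_Lau e (fun l => ?_) (fun l => ?_)
      (ih (j :: L).length (by simp; omega) (j :: L) rfl A3 hg3 i)
    · rw [he']
      by_cases hl : l = j
      · rw [hl, h5]
      · rw [hx3' _ (by simpa using hl)]
        by_cases hl' : l = k
        · rw [hl', h4]
        · rw [hx2' _ (by simpa using hl'), hx1' _ (by simpa using hl), hv0]
    · rw [he', hx3' _ (by simp), hx2' _ (by simp), hx1' _ (by simp)]
      exact val_initX_le _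

/-! ### Homogeneity -/

def HomFor {n : ℕ} (φ : CField n →+* CField n) (x : Fin n ⊕ Fin n → CField n)
    (A : Matrix (Fin n ⊕ Fin n) (Fin n) ℤ) (w : Fin n ⊕ Fin n → ℤ) : Prop :=
  (∀ l, φ (x l) = (2 : CField n) ^ (w l) * x l) ∧ ∀ k, ∑ l, w l * A l k = 0

theorem HomFor.prod {n : ℕ} {φ : CField n →+* CField n} {x : Fin n ⊕ Fin n → CField n}
    {w : Fin n ⊕ Fin n → ℤ} (h : ∀ l, φ (x l) = (2 : CField n) ^ (w l) * x l)
    (a : Fin n ⊕ Fin n → ℕ) :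
    φ (∏ l, x l ^ a l) = (2 : CField n) ^ (∑ l, w l * a l) * ∏ l, x l ^ a l := by
  rw [map_prod]
  have h2 : (2 : CField n) ≠ 0 := two_ne_zero
  have h3 : (2 : CField n) ^ (∑ l, w l * a l) = ∏ l, (2 : CField n) ^ (w l * a l) := by
    induction (Finset.univ : Finset (Fin n ⊕ Fin n)) using Finset.induction_on with
    | empty => simp
    | insert i s hi ih => rw [Finset.sum_insert hi, Finset.prod_insert hi, zpow_add₀ h2, ih]
  rw [h3, ← Finset.prod_mul_distrib]
  refine Finset.prod_congr rfl fun l _ => ?_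
  rw [map_pow, h, mul_pow, zpow_mul, zpow_natCast]

theorem HomFor.mutate {n : ℕ} {φ : CField n →+* CField n} {x : Fin n ⊕ Fin n → CField n}
    {A : Matrix (Fin n ⊕ Fin n) (Fin n) ℤ} {w : Fin n ⊕ Fin n → ℤ} (h : HomFor φ x A w)
    {k : Fin n} (hA : A (Sum.inl k) k = 0) :
    ∃ w', HomFor φ (seedMutX x A k) (matMutate Sum.inl A k) w' := by
  obtain ⟨h1, h2⟩ := h
  set p : ℤ := ∑ l, w l * (-(A l k)).toNat with hp
  have hp' : ∑ l, w l * ((A l k).toNat : ℤ) = p := by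
    rw [← sub_eq_zero, hp, ← Finset.sum_sub_distrib, ← h2 k]
    refine Finset.sum_congr rfl fun l _ => ?_
    rw [← mul_sub]
    congr 1
    omega
  have hex : φ (exch x A k) = (2 : CField n) ^ p * exch x A k := by
    rw [exch, map_add, HomFor.prod h1, HomFor.prod h1, hp', ← hp, mul_add]
  have h20 : (2 : CField n) ≠ 0 := two_ne_zero
  refine ⟨fun l => if l = Sum.inl k then -(w l) + p else w l, ?_, ?_⟩
  · intro l
    by_cases hl : l = Sum.inl k
    · subst hl
      simp only [↓reduceIte]
      rw [seedMutX_self, map_mul, map_inv₀, hex, h1, mul_inv, zpow_add₀ h20, zpow_neg]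
      ring
    · simp only [if_neg hl]
      rw [seedMutX_of_ne _ _ _ _ hl, h1]
  · intro j
    by_cases hj : j = k
    · subst hj
      rw [← neg_eq_zero, ← Finset.sum_neg_distrib, ← h2 j]
      refine Finset.sum_congr rfl fun l _ => ?_
      rw [matMutate_col]
      by_cases hl : l = Sum.inl j
      · rw [hl, hA]; simp
      · simp [hl]
    · have hterm : ∀ l, (if l = Sum.inl k then -(w l) + p else w l) * matMutate Sum.inl A k l j =
          w l * A l j + w l * A l k * max (A (Sum.inl k) j) 0 +
            w l * (-(A l k)).toNat * A (Sum.inl k) j +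
            (if l = Sum.inl k then -(A (Sum.inl k) j) * p else 0) := by
        intro l
        by_cases hl : l = Sum.inl k
        · subst hl
          rw [matMutate_row, hA]
          simp
          ring
        · rw [if_neg hl, if_neg hl, matMutate_of_ne _ _ _ _ hl hj, Int.toNat_eq_max]
          ring
      rw [Finset.sum_congr rfl fun l _ => hterm l, Finset.sum_add_distrib, Finset.sum_add_distrib,
        Finset.sum_add_distrib, ← Finset.sum_mul, ← Finset.sum_mul, ← hp, h2, h2]
      simp
      ring

theorem HomFor.foldl {n : ℕ} {φ : CField n →+* CField n} (L : List (Fin n)) :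
    ∀ {x : Fin n ⊕ Fin n → CField n} {A : Matrix (Fin n ⊕ Fin n) (Fin n) ℤ}
    {w : Fin n ⊕ Fin n → ℤ}, GoodMat A → HomFor φ x A w →
    ∃ w' : Fin n ⊕ Fin n → ℤ, ∀ l, φ ((L.foldl mutatePair (x, A)).1 l) =
      (2 : CField n) ^ (w' l) * (L.foldl mutatePair (x, A)).1 l := by
  induction L with
  | nil => intro x A w _ h; exact ⟨w, h.1⟩
  | cons k L ih =>
    intro x A w hA h
    obtain ⟨w', h'⟩ := h.mutate (hA.diag k)
    exact ih (hA.mutate k) h'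

def degW {n : ℕ} (B : Matrix (Fin n) (Fin n) ℤ) (i : Fin n) : Fin n ⊕ Fin n → ℤ
  | Sum.inl l => if l = i then 1 else 0
  | Sum.inr j => -B i j

theorem exists_scale {n : ℕ} (s : Fin n ⊕ Fin n → ℤ) :
    ∃ φ : CField n →+* CField n, ∀ l, φ (initX n l) = (2 : CField n) ^ (s l) * initX n l := by
  refine exists_hom (fun l => (2 : CField n) ^ (s l) * initX n l) fun l => ?_
  set K := IntermediateField.adjoin ℚ (Set.range fun l => (2 : CField n) ^ (s l) * initX n l)
  have h1 : (2 : CField n) ^ (s l) * initX n l ∈ K :=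
    IntermediateField.subset_adjoin _ _ (Set.mem_range_self l)
  have h2 : (2 : CField n) ^ (-(s l)) ∈ K := zpow_mem (ofNat_mem K 2) _
  have h3 := mul_mem h2 h1
  rwa [← mul_assoc, ← zpow_add₀ two_ne_zero, neg_add_cancel, zpow_zero, one_mul] at h3

theorem homFor_init {n : ℕ} (B : Matrix (Fin n) (Fin n) ℤ) (i : Fin n) {φ : CField n →+* CField n}
    (h : ∀ l, φ (initX n l) = (2 : CField n) ^ (degW B i l) * initX n l) :
    HomFor φ (initX n) (principalExt B) (degW B i) := by
  refine ⟨h, fun k => ?_⟩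
  simp [Fintype.sum_sum_type, degW, principalExt]

/-! ### Laurent expansions -/

abbrev ExpT (n : ℕ) : Type := (Fin n → ℤ) × (Fin n → ℕ)

def lmon {n : ℕ} (p : ExpT n) : CField n :=
  (∏ i : Fin n, (initX n (Sum.inl i)) ^ (p.1 i)) * ∏ i : Fin n, (initX n (Sum.inr i)) ^ (p.2 i)

def lmonHom (n : ℕ) : Multiplicative (ExpT n) →* CField n where
  toFun p := lmon (Multiplicative.toAdd p)
  map_one' := by simp [lmon]
  map_mul' p q := by
    simp only [lmon, toAdd_mul, Prod.fst_add, Prod.snd_add, Pi.add_apply, pow_add,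
      Finset.prod_mul_distrib, zpow_add₀ (initX_ne_zero _)]
    ring

theorem exists_expansion {n : ℕ} {z : CField n} (hz : z ∈ Lau n) :
    ∃ f : ExpT n →₀ ℤ, z = f.sum fun p m => (m : CField n) * lmon p := by
  have hle : Lau n ≤ (AddMonoidAlgebra.lift ℤ (CField n) (ExpT n) (lmonHom n)).toRingHom.range := by
    rw [Lau, Subring.closure_le]
    have key : ∀ p : ExpT n, lmon p ∈
        (AddMonoidAlgebra.lift ℤ (CField n) (ExpT n) (lmonHom n)).toRingHom.range := by
      intro p
      refine ⟨AddMonoidAlgebra.of ℤ (ExpT n) (Multiplicative.ofAdd p), ?_⟩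
      exact AddMonoidAlgebra.lift_of _ _
    rintro z (⟨i | i, rfl⟩ | ⟨i, rfl⟩)
    · have := key (Pi.single i 1, 0)
      rw [lmon, Finset.prod_eq_single i] at this
      · simpa using this
      · intro b _ hb; simp [hb]
      · simp
    · have := key (0, Pi.single i 1)
      rw [lmon, mul_comm, Finset.prod_eq_single i] at this
      · simpa using this
      · intro b _ hb; simp [hb]
      · simp
    · have := key (Pi.single i (-1), 0)
      rw [lmon, Finset.prod_eq_single i] at this
      · simpa using this
      · intro b _ hb; simp [hb]
      · simp
  obtain ⟨f, hf⟩ := hle hz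
  refine ⟨f.coeff, ?_⟩
  rw [← hf]
  have := AddMonoidAlgebra.lift_apply (lmonHom n) f
  refine Eq.trans this ?_
  refine Finsupp.sum_congr fun p _ => ?_
  rw [Algebra.smul_def, eq_intCast]
  rfl

theorem lmon_indep {n : ℕ} (S : Finset (ExpT n)) (c : ExpT n → ℚ)
    (h : ∑ p ∈ S, (c p : CField n) * lmon p = 0) : ∀ p ∈ S, c p = 0 := by
  set N : Fin n → ℕ := fun i => ∑ p ∈ S, (p.1 i).natAbs with hN
  have hNp : ∀ p ∈ S, ∀ i, 0 ≤ (N i : ℤ) + p.1 i := by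
    intro p hp i
    have : (p.1 i).natAbs ≤ N i :=
      Finset.single_le_sum (f := fun p : ExpT n => (p.1 i).natAbs) (fun _ _ => Nat.zero_le _) hp
    omega
  let q : ExpT n → Fin n ⊕ Fin n → ℕ := fun p =>
    Sum.elim (fun i => ((N i : ℤ) + p.1 i).toNat) p.2
  have hq : ∀ p ∈ S, (∏ i, initX n (Sum.inl i) ^ N i) * lmon p =
      algebraMap (MvPolynomial (Fin n ⊕ Fin n) ℚ) (CField n)
        (∏ l, MvPolynomial.X l ^ q p l) := by
    intro p hp
    rw [map_prod, Fintype.prod_sum_type, lmon, ← mul_assoc, ← Finset.prod_mul_distrib]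
    congr 1
    · refine Finset.prod_congr rfl fun i _ => ?_
      rw [map_pow]
      change _ = initX n (Sum.inl i) ^ ((N i : ℤ) + p.1 i).toNat
      rw [← zpow_natCast, ← zpow_natCast, ← zpow_add₀ (initX_ne_zero _),
        Int.toNat_of_nonneg (hNp p hp i)]
    · refine Finset.prod_congr rfl fun i _ => ?_
      rw [map_pow]
      rfl
  have hqm : ∀ p, (∏ l, MvPolynomial.X l ^ q p l : MvPolynomial (Fin n ⊕ Fin n) ℚ) =
      MvPolynomial.monomial (Finsupp.equivFunOnFinite.symm (q p)) 1 := by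
    intro p
    rw [MvPolynomial.monomial_eq]
    simp [Finsupp.prod_fintype]
  have hsum : ∑ p ∈ S, MvPolynomial.monomial (Finsupp.equivFunOnFinite.symm (q p)) (c p) = 0 := by
    apply IsFractionRing.injective (MvPolynomial (Fin n ⊕ Fin n) ℚ) (CField n)
    rw [map_zero, ← mul_zero (∏ i, initX n (Sum.inl i) ^ N i), ← h, Finset.mul_sum, map_sum]
    refine Finset.sum_congr rfl fun p hp => ?_
    rw [mul_left_comm, hq p hp, hqm]
    have : (c p : CField n) = algebraMap (MvPolynomial (Fin n ⊕ Fin n) ℚ) (CField n)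
        (MvPolynomial.C (c p)) :=
      (eq_ratCast ((algebraMap (MvPolynomial (Fin n ⊕ Fin n) ℚ) (CField n)).comp
        MvPolynomial.C) (c p)).symm
    rw [this, ← map_mul, MvPolynomial.C_mul_monomial, mul_one]
  intro p hp
  have h2 := congrArg (MvPolynomial.coeff (Finsupp.equivFunOnFinite.symm (q p))) hsum
  rw [MvPolynomial.coeff_sum, Finset.sum_eq_single p] at h2
  · simpa using h2
  · intro p' hp' hne
    rw [MvPolynomial.coeff_monomial, if_neg]
    intro he
    apply hne
    have he' : q p' = q p := by simpa using he
    refine Prod.ext (funext fun i => ?_) (funext fun i => ?_)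
    · have h3 := congrFun he' (Sum.inl i)
      simp only [q, Sum.elim_inl] at h3
      have := hNp p hp i
      have := hNp p' hp' i
      omega
    · have h3 := congrFun he' (Sum.inr i)
      simpa only [q, Sum.elim_inr] using h3
  · exact fun h => absurd hp h

theorem scale_lmon {n : ℕ} (B : Matrix (Fin n) (Fin n) ℤ) (i : Fin n) {φ : CField n →+* CField n}
    (h : ∀ l, φ (initX n l) = (2 : CField n) ^ (degW B i l) * initX n l) (p : ExpT n) :
    φ (lmon p) = (2 : CField n) ^ (p.1 i - ∑ j, B i j * (p.2 j : ℤ)) * lmon p := by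
  have h2 : (2 : CField n) ≠ 0 := two_ne_zero
  have e1 : φ (∏ l : Fin n, (initX n (Sum.inl l)) ^ (p.1 l)) =
      (2 : CField n) ^ (p.1 i) * ∏ l : Fin n, (initX n (Sum.inl l)) ^ (p.1 l) := by
    have h3 : (2 : CField n) ^ (p.1 i) =
        ∏ l, if l = i then (2 : CField n) ^ (p.1 l) else 1 := by simp
    rw [map_prod, h3, ← Finset.prod_mul_distrib]
    refine Finset.prod_congr rfl fun l _ => ?_
    rw [map_zpow₀, h, mul_zpow]
    by_cases hl : l = i
    · simp [degW, hl]
    · simp [degW, hl]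
  have e2 : φ (∏ l : Fin n, (initX n (Sum.inr l)) ^ (p.2 l)) =
      (2 : CField n) ^ (-∑ j, B i j * (p.2 j : ℤ)) * ∏ l : Fin n, (initX n (Sum.inr l)) ^ (p.2 l) := by
    have h3 : (2 : CField n) ^ (-∑ j, B i j * (p.2 j : ℤ)) =
        ∏ j, (2 : CField n) ^ (-(B i j * (p.2 j : ℤ))) := by
      rw [← Finset.sum_neg_distrib]
      induction (Finset.univ : Finset (Fin n)) using Finset.induction_on with
      | empty => simp
      | insert i s hi ih => rw [Finset.sum_insert hi, Finset.prod_insert hi, zpow_add₀ h2, ih]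
    rw [map_prod, h3, ← Finset.prod_mul_distrib]
    refine Finset.prod_congr rfl fun l _ => ?_
    rw [map_pow, h, mul_pow, ← neg_mul, zpow_mul, zpow_natCast]
    rfl
  rw [lmon, map_mul, e1, e2, sub_eq_add_neg, zpow_add₀ h2]
  ring

theorem homog_of_scale {n : ℕ} (B : Matrix (Fin n) (Fin n) ℤ) (i : Fin n)
    {φ : CField n →+* CField n}
    (h : ∀ l, φ (initX n l) = (2 : CField n) ^ (degW B i l) * initX n l)
    {z : CField n} {g : ℤ} (hz : φ z = (2 : CField n) ^ g * z) {f : ExpT n →₀ ℤ}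
    (hf : z = f.sum fun p m => (m : CField n) * lmon p) :
    ∀ p, f p ≠ 0 → p.1 i - ∑ j, B i j * (p.2 j : ℤ) = g := by
  intro p hp
  have h1 : ∑ p ∈ f.support, (((f p : ℚ) * ((2 : ℚ) ^ (p.1 i - ∑ j, B i j * (p.2 j : ℤ)) -
      (2 : ℚ) ^ g) : ℚ) : CField n) * lmon p = 0 := by
    have h2 : φ z - (2 : CField n) ^ g * z = 0 := by rw [hz, sub_self]
    rw [← h2, hf, Finsupp.sum, map_sum, Finset.mul_sum, ← Finset.sum_sub_distrib]
    refine Finset.sum_congr rfl fun p _ => ?_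
    rw [map_mul, map_intCast, scale_lmon B i h]
    push_cast
    ring
  have h2 := lmon_indep _ _ h1 p (Finsupp.mem_support_iff.mpr hp)
  rcases mul_eq_zero.mp h2 with h3 | h3
  · exact absurd (by exact_mod_cast h3) hp
  · exact zpow_right_injective₀ (a := (2 : ℚ)) (by norm_num) (by norm_num) (sub_eq_zero.mp h3)

/-- existence of g-vectors: for a skew-symmetrizable `B`, every cluster
variable `z` of `A(B)` is homogeneous for the `ℤ^n`-grading with `deg(x_i) = e_i` and
`deg(y_j) = -∑_i b_{ij} e_i`: there exist `g ∈ ℤ^n` and a finitely supported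
`f : ℤ^n × (ℤ_{≥0})^n → ℤ` with `z = ∑_{(a,c)} f(a,c) x^a y^c` and `f(a,c) ≠ 0 → a - B c = g`. -/
theorem g_vector_exists {n : ℕ} (B : Matrix (Fin n) (Fin n) ℤ)
    (hskew : ∃ d : Fin n → ℤ, (∀ i, 0 < d i) ∧ ∀ i j, B i j * d j = -B j i * d i)
    (z : CField n) (hz : IsClusterVariable B z) :
    ∃ (g : Fin n → ℤ) (f : ((Fin n → ℤ) × (Fin n → ℕ)) →₀ ℤ),
      z = f.sum (fun p m =>
          (m : CField n) * (∏ i : Fin n, (initX n (Sum.inl i)) ^ (p.1 i)) *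
            ∏ i : Fin n, (initX n (Sum.inr i)) ^ (p.2 i)) ∧
      ∀ p : (Fin n → ℤ) × (Fin n → ℕ), f p ≠ 0 →
        ∀ i, p.1 i - ∑ j, B i j * (p.2 j : ℤ) = g i := by
  obtain ⟨L, i, rfl⟩ := hz
  have hA := GoodMat.principal hskew
  obtain ⟨f, hf⟩ := exists_expansion (laurent L.length L rfl _ hA (Sum.inl i))
  choose φ hφ using fun i0 : Fin n => exists_scale (degW B i0)
  choose w hw using fun i0 : Fin n => HomFor.foldl L hA (homFor_init B i0 (hφ i0))
  refine ⟨fun i0 => w i0 (Sum.inl i), f, ?_, fun p hp i0 => ?_⟩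
  · rw [hf]
    refine Finsupp.sum_congr fun p _ => ?_
    rw [lmon, mul_assoc]
  · exact homog_of_scale B i0 (hφ i0) (hw i0 (Sum.inl i)) hf p hp
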